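/- With T of class H(α,θ) and L₀f(x) = (1/k)Σ_j f(b_j(x)), the dual operator L₀* acting on Borel probability measures is a θ-contraction for the Wasserstein metric W_α associated to the metric d^α: W_α(L₀*μ, L₀*ν) ≤ θ·W_α(μ,ν). Consequently, by completeness of the Wasserstein metric on a compact space, L₀* has a unique fixed probability measure. -/

import Mathlib

open Set MeasureTheory

/-- The `W_α` Wasserstein distance (Kantorovich duality form): sup of `|∫f dμ - ∫f dν|`
over continuous `f` with `Hol_α(f) ≤ 1`, i.e. `|f x - f y| ≤ d(x,y)^α`. -/
noncomputable def Wass {Ω : Type*} [MetricSpace Ω] [MeasurableSpace Ω]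
    (α : ℝ) (μ ν : Measure Ω) : ℝ :=
  sSup {r : ℝ | ∃ f : Ω → ℝ, Continuous f ∧ (∀ x y : Ω, |f x - f y| ≤ dist x y ^ α) ∧
    r = |(∫ x, f x ∂μ) - ∫ x, f x ∂ν|}

open Filter Topology

section TransferOperator

variable {Ω : Type*} {k : ℕ}

/-- The normalized transfer operator `f ↦ (1/k) ∑ j, f ∘ b j`. -/
noncomputable def transferOp (b : Fin k → Ω → Ω) (f : Ω → ℝ) (x : Ω) : ℝ :=
  (1 / (k : ℝ)) * ∑ j, f (b j x)

/-- The dual transfer operator `μ ↦ (1/k) ∑ j, (b j)_* μ` on measures. -/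
noncomputable def dualTransfer [MeasurableSpace Ω] (b : Fin k → Ω → Ω) (μ : Measure Ω) :
    Measure Ω :=
  (k : ENNReal)⁻¹ • ∑ j, Measure.map (b j) μ

theorem isProbabilityMeasure_dualTransfer [MeasurableSpace Ω] (hk : k ≠ 0) {b : Fin k → Ω → Ω}
    (hb : ∀ j, Measurable (b j)) (μ : Measure Ω) [IsProbabilityMeasure μ] :
    IsProbabilityMeasure (dualTransfer b μ) := by
  have h (j : Fin k) : Measure.map (b j) μ univ = 1 := by
    rw [Measure.map_apply (hb j) MeasurableSet.univ, preimage_univ, measure_univ]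
  constructor
  simp only [dualTransfer, Measure.smul_apply, Measure.finsetSum_apply, h, smul_eq_mul,
    Finset.sum_const, Finset.card_univ, Fintype.card_fin, nsmul_eq_mul, mul_one]
  exact ENNReal.inv_mul_cancel (by exact_mod_cast hk) (ENNReal.natCast_ne_top k)

theorem isProbabilityMeasure_iterate_dualTransfer [MeasurableSpace Ω] (hk : k ≠ 0)
    {b : Fin k → Ω → Ω} (hb : ∀ j, Measurable (b j)) (μ : Measure Ω) [hμ : IsProbabilityMeasure μ]
    (n : ℕ) : IsProbabilityMeasure ((dualTransfer b)^[n] μ) := by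
  induction n with
  | zero => exact hμ
  | succ n ih =>
    rw [Function.iterate_succ_apply']
    exact isProbabilityMeasure_dualTransfer hk hb _

/-- `f` is `α`-Hölder with constant `C`, for a real constant `C` and a real-valued `f`. -/
def HolderBound [MetricSpace Ω] (α C : ℝ) (f : Ω → ℝ) : Prop :=
  ∀ x y, |f x - f y| ≤ C * dist x y ^ α

section MetricSpace

variable [MetricSpace Ω] {α C : ℝ} {f : Ω → ℝ}

theorem HolderBound.continuous (hα : 0 < α) (hf : HolderBound α C f) : Continuous f := by
  refine continuous_iff_continuousAt.2 fun y => ?_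
  rw [ContinuousAt, tendsto_iff_dist_tendsto_zero]
  refine squeeze_zero (fun x => dist_nonneg) (fun x => hf x y) ?_
  have h : Continuous fun x => C * dist x y ^ α :=
    continuous_const.mul ((continuous_id.dist continuous_const).rpow_const fun _ => .inr hα.le)
  simpa [Real.zero_rpow hα.ne'] using h.tendsto y

theorem HolderBound.holderBound_transferOp {θ : ℝ} {b : Fin k → Ω → Ω} (hC : 0 ≤ C)
    (hcontr : ∀ y z : Ω, ∃ σ : Equiv.Perm (Fin k),
      (1 / (k : ℝ)) * ∑ j, dist (b j y) (b (σ j) z) ^ α ≤ θ * dist y z ^ α)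
    (hf : HolderBound α C f) : HolderBound α (C * θ) (transferOp b f) := by
  intro y z
  obtain ⟨σ, hσ⟩ := hcontr y z
  have hk : 0 ≤ 1 / (k : ℝ) := by positivity
  calc |transferOp b f y - transferOp b f z|
      = 1 / (k : ℝ) * |∑ j, (f (b j y) - f (b (σ j) z))| := by
        rw [transferOp, transferOp, ← Equiv.sum_comp σ fun j => f (b j z), ← mul_sub,
          ← Finset.sum_sub_distrib, abs_mul, abs_of_nonneg hk]
    _ ≤ 1 / (k : ℝ) * ∑ j, C * dist (b j y) (b (σ j) z) ^ α := by
        gcongr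
        exact (Finset.abs_sum_le_sum_abs _ _).trans (Finset.sum_le_sum fun j _ => hf _ _)
    _ = C * (1 / (k : ℝ) * ∑ j, dist (b j y) (b (σ j) z) ^ α) := by
        rw [← Finset.mul_sum, mul_left_comm]
    _ ≤ C * (θ * dist y z ^ α) := by gcongr
    _ = C * θ * dist y z ^ α := (mul_assoc _ _ _).symm

variable [CompactSpace Ω]

theorem dist_rpow_le_diam_rpow (hα : 0 ≤ α) (x y : Ω) :
    dist x y ^ α ≤ Metric.diam (univ : Set Ω) ^ α :=
  Real.rpow_le_rpow dist_nonneg (Metric.dist_le_diam_of_mem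
    (Metric.isBounded_of_compactSpace) (mem_univ _) (mem_univ _)) hα

/-- On a compact space, Lipschitz functions are `α`-Hölder for `α ≤ 1`. -/
theorem exists_holderBound_of_lipschitzWith (hα : α ≤ 1) {K : NNReal}
    (hf : LipschitzWith K f) : ∃ C, 0 ≤ C ∧ HolderBound α C f := by
  refine ⟨K * Metric.diam (univ : Set Ω) ^ (1 - α), by positivity, fun x y => ?_⟩
  calc |f x - f y| ≤ K * dist x y := hf.dist_le_mul x y
    _ = K * (dist x y ^ (1 - α) * dist x y ^ α) := by
        rw [← Real.rpow_add' dist_nonneg (by simp), sub_add_cancel, Real.rpow_one]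
    _ ≤ K * (Metric.diam (univ : Set Ω) ^ (1 - α) * dist x y ^ α) := by
        gcongr ?_ * (?_ * _)
        exact dist_rpow_le_diam_rpow (sub_nonneg.2 hα) x y
    _ = _ := (mul_assoc _ _ _).symm

variable [MeasurableSpace Ω] [BorelSpace Ω]

theorem integrable_of_continuous_of_compactSpace (hf : Continuous f) (μ : Measure Ω)
    [IsFiniteMeasure μ] : Integrable f μ :=
  hf.integrable_of_hasCompactSupport (HasCompactSupport.of_compactSpace f)

theorem integral_dualTransfer {b : Fin k → Ω → Ω} (hb : ∀ j, Measurable (b j))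
    (hf : Continuous f) (μ : Measure Ω) [IsFiniteMeasure μ] :
    ∫ x, f x ∂(dualTransfer b μ) = ∫ x, transferOp b f x ∂μ := by
  have hint (j : Fin k) : Integrable f (Measure.map (b j) μ) :=
    integrable_of_continuous_of_compactSpace hf _
  have hcomp (j : Fin k) : Integrable (fun x => f (b j x)) μ :=
    (integrable_map_measure hf.aestronglyMeasurable (hb j).aemeasurable).1 (hint j)
  simp only [dualTransfer, transferOp]
  rw [integral_smul_measure, integral_finsetSum_measure fun j _ => hint j, integral_const_mul,
    integral_finsetSum _ fun j _ => hcomp j]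
  simp [integral_map (hb _).aemeasurable hf.aestronglyMeasurable]

theorem HolderBound.abs_integral_sub_le (hα : 0 < α) (hC : 0 ≤ C) (hf : HolderBound α C f)
    (μ ν : Measure Ω) [IsProbabilityMeasure μ] [IsProbabilityMeasure ν] :
    |(∫ x, f x ∂μ) - ∫ x, f x ∂ν| ≤ C * Metric.diam (univ : Set Ω) ^ α := by
  set M := C * Metric.diam (univ : Set Ω) ^ α
  have hint (ρ : Measure Ω) [IsProbabilityMeasure ρ] : Integrable f ρ :=
    integrable_of_continuous_of_compactSpace (hf.continuous hα) ρ
  have hM (x y : Ω) : |f x - f y| ≤ M :=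
    (hf x y).trans (mul_le_mul_of_nonneg_left (dist_rpow_le_diam_rpow hα.le x y) hC)
  have hx (x : Ω) : |f x - ∫ y, f y ∂ν| ≤ M := by
    have h := norm_integral_le_of_norm_le_const (μ := ν) (f := fun y => f x - f y)
      (Eventually.of_forall (hM x))
    simpa [integral_sub (integrable_const _) (hint ν)] using h
  have h := norm_integral_le_of_norm_le_const (μ := μ) (f := fun x => f x - ∫ y, f y ∂ν)
    (Eventually.of_forall hx)
  simpa [integral_sub (hint μ) (integrable_const _)] using h

theorem bddAbove_wass (hα : 0 < α) (μ ν : Measure Ω) [IsProbabilityMeasure μ]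
    [IsProbabilityMeasure ν] :
    BddAbove {r : ℝ | ∃ f : Ω → ℝ, Continuous f ∧ (∀ x y : Ω, |f x - f y| ≤ dist x y ^ α) ∧
      r = |(∫ x, f x ∂μ) - ∫ x, f x ∂ν|} := by
  refine ⟨1 * Metric.diam (univ : Set Ω) ^ α, ?_⟩
  rintro r ⟨f, -, hf, rfl⟩
  exact HolderBound.abs_integral_sub_le hα zero_le_one (fun x y => by simpa using hf x y) μ ν

theorem HolderBound.abs_integral_sub_le_mul_wass (hα : 0 < α) (hC : 0 < C)
    (hf : HolderBound α C f) (μ ν : Measure Ω) [IsProbabilityMeasure μ] [IsProbabilityMeasure ν] :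
    |(∫ x, f x ∂μ) - ∫ x, f x ∂ν| ≤ C * Wass α μ ν := by
  rw [← div_le_iff₀' hC]
  refine le_csSup (bddAbove_wass hα μ ν) ⟨fun x => f x / C, (hf.continuous hα).div_const C,
    fun x y => ?_, ?_⟩
  · rw [← sub_div, abs_div, abs_of_pos hC, div_le_iff₀' hC]
    exact hf x y
  · rw [integral_div, integral_div, ← sub_div, abs_div, abs_of_pos hC]

variable {θ : ℝ} {b : Fin k → Ω → Ω}

theorem wass_dualTransfer_le (hα : 0 < α) (hθ : 0 < θ) (hb : ∀ j, Measurable (b j))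
    (hcontr : ∀ y z : Ω, ∃ σ : Equiv.Perm (Fin k),
      (1 / (k : ℝ)) * ∑ j, dist (b j y) (b (σ j) z) ^ α ≤ θ * dist y z ^ α)
    (μ ν : Measure Ω) [IsProbabilityMeasure μ] [IsProbabilityMeasure ν] :
    Wass α (dualTransfer b μ) (dualTransfer b ν) ≤ θ * Wass α μ ν := by
  refine csSup_le ⟨_, fun _ => 0, continuous_const, fun x y => by simp; positivity, rfl⟩ ?_
  rintro r ⟨f, hfc, hf, rfl⟩
  rw [integral_dualTransfer hb hfc, integral_dualTransfer hb hfc]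
  have hf' : HolderBound α 1 f := fun x y => by simpa using hf x y
  have h := hf'.holderBound_transferOp zero_le_one hcontr
  rw [one_mul] at h
  exact h.abs_integral_sub_le_mul_wass hα hθ μ ν

theorem HolderBound.abs_integral_iterate_dualTransfer_sub_le (hα : 0 < α) (hθ : 0 < θ)
    (hk : k ≠ 0) (hb : ∀ j, Measurable (b j))
    (hcontr : ∀ y z : Ω, ∃ σ : Equiv.Perm (Fin k),
      (1 / (k : ℝ)) * ∑ j, dist (b j y) (b (σ j) z) ^ α ≤ θ * dist y z ^ α)
    (μ ν : Measure Ω) [IsProbabilityMeasure μ] [IsProbabilityMeasure ν] (n : ℕ)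
    (hC : 0 ≤ C) (hf : HolderBound α C f) :
    |(∫ x, f x ∂((dualTransfer b)^[n] μ)) - ∫ x, f x ∂((dualTransfer b)^[n] ν)| ≤
      C * Metric.diam (univ : Set Ω) ^ α * θ ^ n := by
  induction n generalizing f C with
  | zero => simpa using hf.abs_integral_sub_le hα hC μ ν
  | succ n ih =>
    have := isProbabilityMeasure_iterate_dualTransfer hk hb μ n
    have := isProbabilityMeasure_iterate_dualTransfer hk hb ν n
    rw [Function.iterate_succ_apply', Function.iterate_succ_apply',
      integral_dualTransfer hb (hf.continuous hα), integral_dualTransfer hb (hf.continuous hα)]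
    refine (ih (mul_nonneg hC hθ.le) (hf.holderBound_transferOp hC hcontr)).trans_eq ?_
    ring

theorem HolderBound.tendsto_integral_iterate_dualTransfer_sub (hα : 0 < α) (hθ : θ ∈ Ioo (0 : ℝ) 1)
    (hk : k ≠ 0) (hb : ∀ j, Measurable (b j))
    (hcontr : ∀ y z : Ω, ∃ σ : Equiv.Perm (Fin k),
      (1 / (k : ℝ)) * ∑ j, dist (b j y) (b (σ j) z) ^ α ≤ θ * dist y z ^ α)
    (μ ν : Measure Ω) [IsProbabilityMeasure μ] [IsProbabilityMeasure ν]
    (hC : 0 ≤ C) (hf : HolderBound α C f) :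
    Tendsto (fun n : ℕ => (∫ x, f x ∂((dualTransfer b)^[n] μ)) -
      ∫ x, f x ∂((dualTransfer b)^[n] ν)) atTop (𝓝 0) := by
  refine squeeze_zero_norm (fun n =>
    hf.abs_integral_iterate_dualTransfer_sub_le hα hθ.1 hk hb hcontr μ ν n hC) ?_
  simpa using (tendsto_pow_atTop_nhds_zero_of_lt_one hθ.1.le hθ.2).const_mul
    (C * Metric.diam (univ : Set Ω) ^ α)

/-- On a compact space, probability measures are determined by integrals of Hölder functions. -/
theorem measure_eq_of_forall_holderBound (hα : α ≤ 1) (μ ν : Measure Ω) [IsProbabilityMeasure μ]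
    [IsProbabilityMeasure ν] (h : ∀ (f : Ω → ℝ) (C : ℝ), 0 ≤ C → HolderBound α C f →
      ∫ x, f x ∂μ = ∫ x, f x ∂ν) : μ = ν := by
  let μ' : ProbabilityMeasure Ω := ⟨μ, inferInstance⟩
  let ν' : ProbabilityMeasure Ω := ⟨ν, inferInstance⟩
  have hlim : Tendsto (fun _ : ℕ => μ') atTop (𝓝 ν') := by
    rw [tendsto_iff_forall_lipschitz_integral_tendsto]
    rintro f - ⟨L, hL⟩
    obtain ⟨C, hC, hf⟩ := exists_holderBound_of_lipschitzWith hα hL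
    have heq : ∫ x, f x ∂μ = ∫ x, f x ∂ν := h f C hC hf
    simp only [μ', ν', ProbabilityMeasure.coe_mk, heq]
    exact tendsto_const_nhds
  have heq : μ' = ν' := tendsto_nhds_unique tendsto_const_nhds hlim
  exact congrArg Subtype.val heq

theorem eq_of_dualTransfer_eq (hα : α ∈ Ioc (0 : ℝ) 1) (hθ : θ ∈ Ioo (0 : ℝ) 1)
    (hk : k ≠ 0) (hb : ∀ j, Measurable (b j))
    (hcontr : ∀ y z : Ω, ∃ σ : Equiv.Perm (Fin k),
      (1 / (k : ℝ)) * ∑ j, dist (b j y) (b (σ j) z) ^ α ≤ θ * dist y z ^ α)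
    {μ ν : Measure Ω} [IsProbabilityMeasure μ] [IsProbabilityMeasure ν]
    (hμ : dualTransfer b μ = μ) (hν : dualTransfer b ν = ν) : μ = ν := by
  refine measure_eq_of_forall_holderBound hα.2 μ ν fun f C hC hf => ?_
  have h := hf.tendsto_integral_iterate_dualTransfer_sub hα.1 hθ hk hb hcontr μ ν hC
  simp only [Function.iterate_fixed hμ, Function.iterate_fixed hν] at h
  exact sub_eq_zero.1 (tendsto_nhds_unique tendsto_const_nhds h)

/-- A limit point of the orbit of any probability measure is fixed by the dual operator. -/
theorem exists_dualTransfer_eq [Nonempty Ω] (hα : α ∈ Ioc (0 : ℝ) 1) (hθ : θ ∈ Ioo (0 : ℝ) 1)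
    (hk : k ≠ 0) (hb : ∀ j, Measurable (b j))
    (hcontr : ∀ y z : Ω, ∃ σ : Equiv.Perm (Fin k),
      (1 / (k : ℝ)) * ∑ j, dist (b j y) (b (σ j) z) ^ α ≤ θ * dist y z ^ α) :
    ∃ μ : Measure Ω, IsProbabilityMeasure μ ∧ dualTransfer b μ = μ := by
  let δ : Measure Ω := Measure.dirac (Classical.arbitrary Ω)
  let u (n : ℕ) : ProbabilityMeasure Ω :=
    ⟨(dualTransfer b)^[n] δ, isProbabilityMeasure_iterate_dualTransfer hk hb δ n⟩
  obtain ⟨μ, -, hμ⟩ := (isCompact_univ (X := ProbabilityMeasure Ω)).ultrafilter_le_nhds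
    ((hyperfilter ℕ).map u) (by simp)
  have hlim : Tendsto u (hyperfilter ℕ) (𝓝 μ) := hμ
  have hle : (hyperfilter ℕ : Filter ℕ) ≤ atTop := Nat.hyperfilter_le_atTop
  have hint {g : Ω → ℝ} (hg : Continuous g) :
      Tendsto (fun n => ∫ x, g x ∂((dualTransfer b)^[n] δ)) (hyperfilter ℕ)
        (𝓝 (∫ x, g x ∂(μ : Measure Ω))) :=
    ProbabilityMeasure.tendsto_iff_forall_integral_tendsto.1 hlim
      (BoundedContinuousFunction.mkOfCompact ⟨g, hg⟩)
  have hPδ := isProbabilityMeasure_dualTransfer hk hb δ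
  have hPμ := isProbabilityMeasure_dualTransfer hk hb (μ : Measure Ω)
  refine ⟨μ, inferInstance, measure_eq_of_forall_holderBound hα.2 _ _ fun f C hC hf => ?_⟩
  have hfc := hf.continuous hα.1
  have h₁ := (hint ((hf.holderBound_transferOp hC hcontr).continuous hα.1)).sub (hint hfc)
  have h₂ := (hf.tendsto_integral_iterate_dualTransfer_sub hα.1 hθ hk hb hcontr
    (dualTransfer b δ) δ hC).mono_left hle
  rw [integral_dualTransfer hb hfc]
  refine sub_eq_zero.1 (tendsto_nhds_unique (h₁.congr fun n => ?_) h₂)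
  have := isProbabilityMeasure_iterate_dualTransfer hk hb δ n
  rw [← Function.iterate_succ_apply, Function.iterate_succ_apply', integral_dualTransfer hb hfc]

end MetricSpace

end TransferOperator

/-- for `T` of class `H(α,θ)`, the dual transfer operator
`L₀*μ = (1/k)Σ_j (b_j)_*μ` is a `θ`-contraction in `W_α` on probability measures; by
completeness it has a unique fixed probability measure. -/
theorem dual_transfer_wasserstein_contraction {Ω : Type*} [MetricSpace Ω] [CompactSpace Ω]
    [MeasurableSpace Ω] [BorelSpace Ω] [Nonempty Ω]
    (α θ : ℝ) (hα : α ∈ Set.Ioc (0:ℝ) 1) (hθ : θ ∈ Set.Ioo (0:ℝ) 1)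
    (k : ℕ) (hk : 2 ≤ k) (b : Fin k → Ω → Ω) (hb : ∀ j, Measurable (b j))
    (hcontr : ∀ y z : Ω, ∃ σ : Equiv.Perm (Fin k),
      (1 / (k : ℝ)) * ∑ j, dist (b j y) (b (σ j) z) ^ α ≤ θ * dist y z ^ α) :
    (∀ μ ν : Measure Ω, IsProbabilityMeasure μ → IsProbabilityMeasure ν →
      Wass α ((k : ENNReal)⁻¹ • ∑ j, Measure.map (b j) μ)
        ((k : ENNReal)⁻¹ • ∑ j, Measure.map (b j) ν) ≤ θ * Wass α μ ν) ∧
    (∃! μ₀ : Measure Ω, IsProbabilityMeasure μ₀ ∧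
      (k : ENNReal)⁻¹ • (∑ j, Measure.map (b j) μ₀) = μ₀) := by
  have hk₀ : k ≠ 0 := by omega
  refine ⟨fun μ ν _ _ => wass_dualTransfer_le hα.1 hθ.1 hb hcontr μ ν, ?_⟩
  obtain ⟨μ, hμ, hfix⟩ := exists_dualTransfer_eq hα hθ hk₀ hb hcontr
  exact ⟨μ, ⟨hμ, hfix⟩, fun ν ⟨_, hν⟩ => eq_of_dualTransfer_eq hα hθ hk₀ hb hcontr hν hfix⟩
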